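/- arXiv:1801.00951 — 3 statements merged into one kernel-verified Lean document; each statement's English description precedes it below -/
import Mathlib

section
/- Let F be a field of characteristic p > 0 and let G be a finite group. Then the group algebra F[G] is a centrally essential ring if and only if there exist subgroups P and H of G such that G is the internal direct product of P and H, P is the (necessarily unique and normal) Sylow p-subgroup of G, H is commutative, and the group algebra F[P] is a centrally essential ring. -/
/-- A ring `R` is *centrally essential* if for every nonzero `r ∈ R` there is a central
element `c` such that `c * r` is a nonzero central element. -/
def IsCentrallyEssential (R : Type*) [Ring R] : Prop :=
  ∀ r : R, r ≠ 0 → ∃ c ∈ Subring.center R, c * r ≠ 0 ∧ c * r ∈ Subring.center R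

open MonoidAlgebra in
lemma aux_mem_center {F G : Type*} [Field F] [Group G] (z : MonoidAlgebra F G)
    (h : ∀ g : G, single g 1 * z = z * single g 1) : z ∈ Subring.center (MonoidAlgebra F G) := by
  rw [Subring.mem_center_iff]
  intro x
  induction x using MonoidAlgebra.induction_linear with
  | zero => simp
  | add a b ha hb => rw [add_mul, mul_add, ha, hb]
  | single g r =>
    have e : (single g r : MonoidAlgebra F G) = r • single g 1 := by simp
    rw [e, smul_mul_assoc, h, mul_smul_comm]

lemma aux_idem {R : Type*} [Ring R] (hR : IsCentrallyEssential R) (e : R) (he : e * e = e) :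
    e ∈ Subring.center R := by
  have key : ∀ (f : R), f * f = f → ∀ x, f * x * (1 - f) = 0 := by
    intro f hf x
    by_contra hne
    obtain ⟨c, hc, h1, h2⟩ := hR _ hne
    rw [Subring.mem_center_iff] at hc h2
    apply h1
    have a1 : f * (c * (f * x * (1 - f))) = c * (f * x * (1 - f)) := by
      rw [← mul_assoc, hc f, mul_assoc, ← mul_assoc f, ← mul_assoc f, hf]
    have a2 : (c * (f * x * (1 - f))) * f = 0 := by
      have : (1 - f) * f = 0 := by rw [sub_mul, hf, one_mul, sub_self]
      rw [mul_assoc, mul_assoc, this, mul_zero, mul_zero]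
    rw [← a1, h2, a2]
  rw [Subring.mem_center_iff]
  intro x
  have k1 := key e he x
  have k2 := key (1 - e) (by rw [mul_sub, sub_mul, sub_mul, he]; simp) x
  simp only [sub_mul, mul_sub, one_mul, mul_one, sub_sub_cancel] at k1 k2
  have k1' := sub_eq_zero.1 k1
  have k2' := sub_eq_zero.1 k2
  rw [k1', k2']

lemma aux_regular {R : Type*} [Ring R] [IsSemisimpleRing R] (a : R) : ∃ b, a = a * b * a := by
  obtain ⟨J, hJ⟩ := exists_isCompl (Submodule.span R {a})
  have h1 : (1 : R) ∈ Submodule.span R {a} ⊔ J := by rw [hJ.sup_eq_top]; trivial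
  obtain ⟨e, he, f, hf, hef⟩ := Submodule.mem_sup.1 h1
  obtain ⟨b, rfl⟩ := Submodule.mem_span_singleton.1 he
  refine ⟨b, ?_⟩
  have h2 : a * f ∈ Submodule.span R {a} := by
    have : a * f = (1 - a * b) • a := by
      rw [← sub_eq_of_eq_add' hef.symm]
      simp [mul_sub, sub_mul, mul_assoc]
    rw [this]
    exact Submodule.smul_mem _ _ (Submodule.mem_span_singleton_self a)
  have h3 : a * f ∈ J := J.smul_mem a hf
  have h4 : a * f = 0 := (Submodule.disjoint_def.1 hJ.disjoint) _ h2 h3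
  have : a = a * (b • a + f) := by rw [hef, mul_one]
  rw [mul_add, h4, add_zero, smul_eq_mul, ← mul_assoc] at this
  exact this

open MonoidAlgebra in
lemma aux_normal {F G : Type*} [Field F] [Group G] [Finite G]
    (hR : IsCentrallyEssential (MonoidAlgebra F G)) (K : Subgroup G)
    (hK : (Nat.card K : F) ≠ 0) : K.Normal := by
  classical
  have := Fintype.ofFinite K
  set E : MonoidAlgebra F G := ∑ k : K, single (k : G) ((Nat.card K : F)⁻¹) with hE
  have hcoeff : ∀ x, E.coeff x = if x ∈ K then (Nat.card K : F)⁻¹ else 0 := by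
    intro x
    rw [hE, coeff_sum, Finsupp.finsetSum_apply]
    simp only [coeff_single, Finsupp.single_apply]
    split_ifs with hx
    · rw [Finset.sum_eq_single ⟨x, hx⟩] <;> simp
      intro a b c d; exact absurd d c
    · apply Finset.sum_eq_zero
      intro k _
      rw [if_neg]
      rintro rfl
      exact hx k.2
  have hmul : ∀ k : K, single (k : G) ((Nat.card K : F)⁻¹) * E = (Nat.card K : F)⁻¹ • E := by
    intro k
    ext x
    simp [coeff_single_mul_apply, hcoeff, K.mul_mem_cancel_left]
  have hidem : E * E = E := by
    conv_lhs => rw [hE, Finset.sum_mul]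
    rw [← hE, Finset.sum_congr rfl (fun k _ => hmul k), Finset.sum_const, Finset.card_univ,
      ← Nat.card_eq_fintype_card, ← Nat.cast_smul_eq_nsmul F, smul_smul, mul_inv_cancel₀ hK, one_smul]
  have hc := Subring.mem_center_iff.1 (aux_idem hR E hidem)
  constructor
  intro k hk g
  have h1 := congrArg (fun z => z.coeff (g * k)) (hc (single g 1))
  simp only [coeff_single_mul_apply, coeff_mul_single_apply, hcoeff] at h1
  by_contra hn
  simp [hk, hn] at h1
  simp [h1] at hK

open MonoidAlgebra in
lemma aux_central {F G : Type*} [Field F] [Group G] [Finite G]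
    (hR : IsCentrallyEssential (MonoidAlgebra F G)) (h : G)
    (hh : (orderOf h : F) ≠ 0) (g : G) : g * h = h * g := by
  have hK : (Nat.card (Subgroup.zpowers h) : F) ≠ 0 := by rwa [Nat.card_zpowers]
  have hN := aux_normal hR _ hK
  have hmem : h ∈ Subgroup.zpowers h := Subgroup.mem_zpowers h
  have hmem' := hN.conj_mem h hmem g
  have : NeZero (Nat.card (Subgroup.zpowers h) : F) := ⟨hK⟩
  let ι := mapDomainRingHom F (Subgroup.zpowers h).subtype
  set a : MonoidAlgebra F G := single h 1 - single (g * h * g⁻¹) 1 with ha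
  have hreg : ∃ b, a = a * b * a := by
    obtain ⟨b, hb⟩ := aux_regular (single (⟨h, hmem⟩ : Subgroup.zpowers h) (1 : F)
      - single (⟨_, hmem'⟩ : Subgroup.zpowers h) (1 : F))
    refine ⟨ι b, ?_⟩
    have h1 := congrArg ι hb
    have h2 : ι (single (⟨h, hmem⟩ : Subgroup.zpowers h) (1 : F)
      - single (⟨_, hmem'⟩ : Subgroup.zpowers h) (1 : F)) = a := by
      rw [map_sub, ha]
      simp [ι]
    rwa [map_mul, map_mul, h2] at h1
  obtain ⟨b, hb⟩ := hreg
  by_contra hne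
  have hane : a ≠ 0 := by
    intro h0
    have h1 : (single h 1 : MonoidAlgebra F G) = single (g * h * g⁻¹) 1 := sub_eq_zero.1 h0
    have h2 := congrArg (fun z => z.coeff h) h1
    have : g * h * g⁻¹ ≠ h := fun h' => hne (by rw [mul_inv_eq_iff_eq_mul] at h'; exact h')
    simp [Finsupp.single_apply, this] at h2
  set e := a * b with he
  have hidem : e * e = e := by rw [he, ← mul_assoc, ← hb]
  have hec := Subring.mem_center_iff.1 (aux_idem hR e hidem)
  have hene : e ≠ 0 := by
    intro h0
    rw [h0, zero_mul] at hb
    exact hane hb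
  have hu : ∀ x : G, (single x 1 * single x⁻¹ 1 : MonoidAlgebra F G) = 1 := by
    intro x; simp [single_mul_single, one_def]
  have hr : e * single h 1 ≠ 0 := by
    intro h0
    apply hene
    rw [← mul_one e, ← hu h, ← mul_assoc, h0, zero_mul]
  obtain ⟨c, hc, h1, h2⟩ := hR _ hr
  rw [Subring.mem_center_iff] at hc h2
  have h3 := h2 (single g 1)
  have h4 : c * (e * single h 1) = c * (e * single (g * h * g⁻¹) 1) := by
    have : (single (g * h * g⁻¹) 1 : MonoidAlgebra F G) = single g 1 * single h 1 * single g⁻¹ 1 := by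
      simp [single_mul_single]
    calc c * (e * single h 1) = c * (e * single h 1) * single g 1 * single g⁻¹ 1 := by
          rw [mul_assoc _ (single g 1), hu, mul_one]
      _ = single g 1 * (c * (e * single h 1)) * single g⁻¹ 1 := by rw [h3]
      _ = c * (e * (single g 1 * single h 1 * single g⁻¹ 1)) := by
          rw [← mul_assoc (single g 1) c, hc, mul_assoc c, ← mul_assoc (single g 1) e, hec]
          simp only [mul_assoc]
      _ = _ := by rw [this]
  have h5 : c * (e * a) = 0 := by
    rw [ha, mul_sub, mul_sub, h4, sub_self]
  have h6 : c * e = 0 := by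
    rw [← hidem]
    nth_rewrite 2 [he]
    rw [← mul_assoc e, ← mul_assoc c, h5, zero_mul]
  apply h1
  rw [← mul_assoc, h6, zero_mul]

lemma auxPi_inj {G : Type*} [Group G] (P : Subgroup G) (h : G) :
    Function.Injective (fun x : P => (x : G) * h) :=
  fun _ _ hxy => Subtype.ext (mul_right_cancel hxy)

/-- The slice of an element of `F[G]` along the coset `P h`. -/
noncomputable def auxPi {F G : Type*} [Field F] [Group G] (P : Subgroup G) (h : G) :
    MonoidAlgebra F G →+ MonoidAlgebra F P where
  toFun r := MonoidAlgebra.comapDomain (fun x : P => (x : G) * h) (auxPi_inj P h) r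
  map_zero' := by simp
  map_add' := by intro x y; simp

lemma auxPi_coeff {F G : Type*} [Field F] [Group G] (P : Subgroup G) (h : G)
    (r : MonoidAlgebra F G) (x : P) : (auxPi P h r).coeff x = r.coeff (x * h) := by
  simp [auxPi]

open MonoidAlgebra in
lemma auxPi_left {F G : Type*} [Field F] [Group G] (P : Subgroup G) (h : G)
    (r : MonoidAlgebra F G) (a : MonoidAlgebra F P) :
    auxPi P h (mapDomainRingHom F P.subtype a * r) = a * auxPi P h r := by
  induction a using MonoidAlgebra.induction_linear with
  | zero => simp
  | add a b ha hb => rw [map_add, add_mul, map_add, ha, hb, add_mul]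
  | single g s =>
    ext x
    simp [auxPi_coeff, mul_assoc]

open MonoidAlgebra in
lemma auxPi_right {F G : Type*} [Field F] [Group G] (P : Subgroup G) (h : G)
    (hh : ∀ g, g * h = h * g)
    (r : MonoidAlgebra F G) (a : MonoidAlgebra F P) :
    auxPi P h (r * mapDomainRingHom F P.subtype a) = auxPi P h r * a := by
  induction a using MonoidAlgebra.induction_linear with
  | zero => simp
  | add a b ha hb => rw [map_add, mul_add, map_add, ha, hb, mul_add]
  | single g s =>
    ext x
    simp [auxPi_coeff, mul_assoc, hh]

lemma auxPi_ext {F G : Type*} [Field F] [Group G] (P H : Subgroup G)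
    (hPH : ∀ g, ∃ x ∈ P, ∃ h ∈ H, g = x * h) (r s : MonoidAlgebra F G)
    (hrs : ∀ h ∈ H, auxPi P h r = auxPi P h s) : r = s := by
  ext g
  obtain ⟨x, hx, h, hh, rfl⟩ := hPH g
  have := congrArg (fun z => z.coeff ⟨x, hx⟩) (hrs h hh)
  simpa [auxPi_coeff] using this

open MonoidAlgebra in
lemma aux_down {F G : Type*} [Field F] [Group G] (P H : Subgroup G)
    (hPH : ∀ g, ∃ x ∈ P, ∃ h ∈ H, g = x * h) (hH : ∀ h ∈ H, ∀ g, g * h = h * g)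
    (hR : IsCentrallyEssential (MonoidAlgebra F G)) :
    IsCentrallyEssential (MonoidAlgebra F P) := by
  intro r hr
  set ι := mapDomainRingHom F P.subtype with hι
  have hπ1 : auxPi P 1 (ι r) = r := by
    have h1 : auxPi P 1 (1 : MonoidAlgebra F G) = 1 := by
      classical
      ext x
      simp [auxPi_coeff, one_def, Finsupp.single_apply]
      simp only [eq_comm, OneMemClass.coe_eq_one]
    have := auxPi_left P 1 1 r
    rwa [mul_one, h1, mul_one] at this
  have hr' : ι r ≠ 0 := by
    intro h0
    rw [h0, map_zero] at hπ1
    exact hr hπ1.symm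
  obtain ⟨c, hc, h1, h2⟩ := hR _ hr'
  have hcen : ∀ h ∈ H, ∀ z ∈ Subring.center (MonoidAlgebra F G),
      auxPi P h z ∈ Subring.center (MonoidAlgebra F P) := by
    intro h hh z hz
    rw [Subring.mem_center_iff] at hz ⊢
    intro a
    rw [← auxPi_left, ← auxPi_right _ _ (hH h hh), hz]
  have : ∃ h ∈ H, auxPi P h (c * ι r) ≠ 0 := by
    by_contra! hcon
    exact h1 (auxPi_ext P H hPH _ _ (by simpa using hcon))
  obtain ⟨h, hh, hne⟩ := this
  refine ⟨auxPi P h c, hcen h hh c hc, ?_, ?_⟩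
  · rwa [← auxPi_right _ _ (hH h hh)]
  · rw [← auxPi_right _ _ (hH h hh)]
    exact hcen h hh _ h2

open MonoidAlgebra in
lemma aux_up {F G : Type*} [Field F] [Group G] [Finite G] (P H : Subgroup G)
    (hPH : ∀ g, ∃ x ∈ P, ∃ h ∈ H, g = x * h) (hH : ∀ h ∈ H, ∀ g, g * h = h * g)
    (hR : IsCentrallyEssential (MonoidAlgebra F P)) :
    IsCentrallyEssential (MonoidAlgebra F G) := by
  classical
  intro r hr
  set ι := mapDomainRingHom F P.subtype with hι
  have key : ∀ S : Finset H, ∃ c ∈ Subring.center (MonoidAlgebra F P), ι c * r ≠ 0 ∧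
      ∀ h ∈ S, auxPi P (h : G) (ι c * r) ∈ Subring.center (MonoidAlgebra F P) := by
    intro S
    induction S using Finset.induction_on with
    | empty => exact ⟨1, one_mem _, by simpa using hr, by simp⟩
    | insert h S _ ih =>
      obtain ⟨c, hc, h1, h2⟩ := ih
      by_cases h0 : auxPi P (h : G) (ι c * r) = 0
      · refine ⟨c, hc, h1, ?_⟩
        intro k hk
        rcases Finset.mem_insert.1 hk with rfl | hk
        · rw [h0]; exact zero_mem _
        · exact h2 k hk
      · obtain ⟨d, hd, h3, h4⟩ := hR _ h0
        refine ⟨d * c, mul_mem hd hc, ?_, ?_⟩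
        · intro h5
          apply h3
          rw [← auxPi_left, ← mul_assoc, ← hι, ← map_mul, h5, map_zero]
        · intro k hk
          rw [map_mul ι, mul_assoc, auxPi_left]
          rcases Finset.mem_insert.1 hk with rfl | hk
          · exact h4
          · exact mul_mem hd (h2 k hk)
  have hcen : ∀ z : MonoidAlgebra F G,
      (∀ h ∈ H, auxPi P h z ∈ Subring.center (MonoidAlgebra F P)) →
      z ∈ Subring.center (MonoidAlgebra F G) := by
    intro z hz
    apply aux_mem_center
    intro g
    obtain ⟨x, hx, h, hh, rfl⟩ := hPH g
    have e1 : (single (x * h) 1 : MonoidAlgebra F G) = single x 1 * single h 1 := by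
      simp [single_mul_single]
    have e2 : (single h 1 : MonoidAlgebra F G) * z = z * single h 1 := by
      ext y
      have : h⁻¹ * y = y * h⁻¹ := (hH h⁻¹ (H.inv_mem hh) y).symm
      simp [this]
    have e3 : (single x 1 : MonoidAlgebra F G) * z = z * single x 1 := by
      have e4 : (single x 1 : MonoidAlgebra F G) = ι (single ⟨x, hx⟩ 1) := by simp [hι]
      rw [e4]
      apply auxPi_ext P H hPH
      intro k hk
      rw [hι, auxPi_left, auxPi_right _ _ (hH k hk)]
      exact Subring.mem_center_iff.1 (hz k hk) _
    rw [e1, mul_assoc, e2, ← mul_assoc, e3, mul_assoc]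
  have := Fintype.ofFinite H
  obtain ⟨c, hc, h1, h2⟩ := key Finset.univ
  refine ⟨ι c, ?_, h1, hcen _ fun h hh => h2 ⟨h, hh⟩ (Finset.mem_univ _)⟩
  apply hcen
  intro h hh
  rw [Subring.mem_center_iff] at hc ⊢
  intro a
  rw [← auxPi_left, ← auxPi_right _ _ (hH h hh), ← hι, ← map_mul, ← map_mul, hc]

lemma aux_group {G : Type*} [Group G] [Finite G] (p : ℕ) [Fact p.Prime]
    (hc : ∀ h : G, ¬ p ∣ orderOf h → ∀ g, g * h = h * g) :
    ∃ P H : Subgroup G, P.Normal ∧ H.Normal ∧ P ⊓ H = ⊥ ∧ P ⊔ H = ⊤ ∧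
        (∀ Q : Sylow p G, (Q : Subgroup G) = P) ∧ (∀ h ∈ H, ∀ g, g * h = h * g) := by
  have hp : p.Prime := Fact.out
  let H : Subgroup G :=
    { carrier := {h | ¬ p ∣ orderOf h}
      one_mem' := by simpa using hp.ne_one
      mul_mem' := by
        intro a b ha hb hab
        have hcomm : Commute a b := hc b hb a
        rcases hp.dvd_mul.1 (hab.trans hcomm.orderOf_mul_dvd_mul_orderOf) with h | h
        · exact ha h
        · exact hb h
      inv_mem' := by
        intro a ha
        simpa using ha }
  have hH : ∀ h ∈ H, ∀ g, g * h = h * g := fun h hh => hc h hh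
  have hHn : H.Normal := ⟨fun h hh g => by rw [hH h hh g]; simpa using hh⟩
  obtain ⟨P⟩ : Nonempty (Sylow p G) := inferInstance
  have hq : IsPGroup p (G ⧸ H) := by
    rw [isPGroup_iff_pow_pow_eq_one]
    intro x
    obtain ⟨g, rfl⟩ := QuotientGroup.mk_surjective x
    refine ⟨(orderOf g).factorization p, ?_⟩
    rw [← QuotientGroup.mk_pow, QuotientGroup.eq_one_iff]
    change ¬ p ∣ orderOf (g ^ _)
    rw [orderOf_pow_of_dvd (pow_ne_zero _ hp.ne_zero) (Nat.ordProj_dvd _ _)]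
    exact Nat.not_dvd_ordCompl hp (orderOf_pos g).ne'
  have hsup : (P : Subgroup G) ⊔ H = ⊤ := by
    rw [← Subgroup.index_eq_one]
    obtain ⟨n, hn⟩ := IsPGroup.iff_card.1 hq
    have h1 : ((P : Subgroup G) ⊔ H).index ∣ p ^ n := by
      rw [← hn]
      exact Subgroup.index_dvd_of_le le_sup_right
    have h2 : ((P : Subgroup G) ⊔ H).index ∣ (P : Subgroup G).index :=
      Subgroup.index_dvd_of_le le_sup_left
    have h3 : Nat.Coprime (p ^ n) (P : Subgroup G).index :=
      Nat.Coprime.pow_left _ ((Nat.Prime.coprime_iff_not_dvd hp).2 P.not_dvd_index)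
    exact Nat.eq_one_of_dvd_coprimes h3 h1 h2
  have hPn : (P : Subgroup G).Normal := by
    rw [← Subgroup.normalizer_eq_top_iff, eq_top_iff, ← hsup, sup_le_iff]
    refine ⟨Subgroup.le_normalizer, ?_⟩
    intro h hh
    rw [Subgroup.mem_normalizer_iff]
    intro x
    rw [← hH h hh x, mul_inv_cancel_right]
  refine ⟨P, H, hPn, hHn, ?_, hsup, ?_, hH⟩
  · rw [eq_bot_iff]
    rintro x ⟨hx, hx'⟩
    rw [Subgroup.mem_bot]
    by_contra hne
    have h1 := P.2.dvd_orderOf (g := ⟨x, hx⟩) (by simpa [Subtype.ext_iff] using hne)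
    rw [Subgroup.orderOf_mk] at h1
    exact hx' h1
  · intro Q
    have := Sylow.unique_of_normal P hPn
    rw [Subsingleton.elim Q P]

theorem centrally_essential_group_algebra_iff
    (F : Type*) [Field F] (p : ℕ) [Fact p.Prime] [CharP F p]
    (G : Type*) [Group G] [Fintype G] :
    IsCentrallyEssential (MonoidAlgebra F G) ↔
      ∃ P H : Subgroup G,
        P.Normal ∧ H.Normal ∧ P ⊓ H = ⊥ ∧ P ⊔ H = ⊤ ∧
        (∀ Q : Sylow p G, (Q : Subgroup G) = P) ∧
        (∀ x y : H, x * y = y * x) ∧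
        IsCentrallyEssential (MonoidAlgebra F P) := by
  have hmul : ∀ P H : Subgroup G, H.Normal → P ⊔ H = ⊤ →
      ∀ g, ∃ x ∈ P, ∃ h ∈ H, g = x * h := by
    intro P H hH hs g
    have : g ∈ P ⊔ H := by rw [hs]; trivial
    obtain ⟨x, hx, h, hh, e⟩ := Subgroup.mem_sup_of_normal_right.1 this
    exact ⟨x, hx, h, hh, e.symm⟩
  constructor
  · intro hR
    obtain ⟨P, H, h1, h2, h3, h4, h5, h6⟩ := aux_group (G := G) p (fun h hh g =>
      aux_central hR h (by rwa [Ne, CharP.cast_eq_zero_iff F p]) g)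
    exact ⟨P, H, h1, h2, h3, h4, h5, fun x y => Subtype.ext (h6 y y.2 x),
      aux_down P H (hmul P H h2 h4) h6 hR⟩
  · rintro ⟨P, H, h1, h2, h3, h4, h5, h6, h7⟩
    have hPH := hmul P H h2 h4
    refine aux_up P H hPH ?_ h7
    intro h hh g
    obtain ⟨x, hx, k, hk, rfl⟩ := hPH g
    have e1 : x * h = h * x := Subgroup.commute_of_normal_of_disjoint P H h1 h2
      (disjoint_iff.2 h3) x h hx hh
    have e2 : k * h = h * k := congrArg Subtype.val (h6 ⟨k, hk⟩ ⟨h, hh⟩)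
    rw [mul_assoc, e2, ← mul_assoc, e1, mul_assoc]
end

section
/- Let F be a field of characteristic p > 0, let q be a prime different from p, and let G be a group such that the group algebra F[G] is a centrally essential ring. Then every q-subgroup of G (i.e., every subgroup all of whose elements have order a power of q) is a normal commutative subgroup of G. -/
theorem ce_idem_central {R : Type*} [Ring R] (h : IsCentrallyEssential R) (e : R)
    (he : e * e = e) (x : R) : e * x = x * e := by
  have h1 : ∀ x : R, e * x * (1 - e) = 0 := by
    intro x
    by_contra hne
    obtain ⟨c, hc, hcr, hcc⟩ := h _ hne
    rw [Subring.mem_center_iff] at hc hcc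
    apply hcr
    have h2 : e * (c * (e * x * (1 - e))) = c * (e * x * (1 - e)) := by
      rw [← mul_assoc, hc e, mul_assoc, ← mul_assoc e, ← mul_assoc e, he]
    rw [← h2, hcc e]
    have : (1 - e) * e = 0 := by rw [sub_mul, he, one_mul, sub_self]
    rw [mul_assoc, mul_assoc (e * x), this, mul_zero, mul_zero]
  have h1' : ∀ x : R, (1 - e) * x * e = 0 := by
    intro x
    by_contra hne
    obtain ⟨c, hc, hcr, hcc⟩ := h _ hne
    rw [Subring.mem_center_iff] at hc hcc
    apply hcr
    have h2 : (c * ((1 - e) * x * e)) * e = c * ((1 - e) * x * e) := by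
      rw [mul_assoc, mul_assoc _ e e, he]
    have : e * (1 - e) = 0 := by rw [mul_sub, he, mul_one, sub_self]
    rw [← h2, ← hcc e, ← mul_assoc, hc e, mul_assoc c, ← mul_assoc e, ← mul_assoc e, this,
      zero_mul, zero_mul, mul_zero]
  have a := h1 x
  have b := h1' x
  rw [mul_sub, mul_one, sub_eq_zero] at a
  rw [sub_mul, one_mul, sub_mul, sub_eq_zero] at b
  rw [a, b]

theorem ce_subgroup_normal {F : Type*} [Field F] {G : Type*} [Group G]
    (h : IsCentrallyEssential (MonoidAlgebra F G)) (K : Subgroup G) [Finite K]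
    (hK : (Nat.card K : F) ≠ 0) : K.Normal := by
  classical
  have := Fintype.ofFinite K
  set s : MonoidAlgebra F G := ∑ k : K, MonoidAlgebra.single (k : G) 1 with hs
  have hks : ∀ k : K, MonoidAlgebra.single (k : G) (1 : F) * s = s := by
    intro k
    rw [hs, Finset.mul_sum]
    refine Fintype.sum_equiv (Equiv.mulLeft k) _ _ ?_
    intro x
    simp [MonoidAlgebra.single_mul_single]
  have hss : s * s = (Nat.card K : F) • s := by
    conv_lhs => enter [1]; rw [hs]
    rw [Finset.sum_mul, Finset.sum_congr rfl (fun k _ => hks k)]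
    simp [Nat.card_eq_fintype_card, Nat.cast_smul_eq_nsmul]
  have hidem : ((Nat.card K : F)⁻¹ • s) * ((Nat.card K : F)⁻¹ • s) = (Nat.card K : F)⁻¹ • s := by
    rw [smul_mul_smul_comm, hss, smul_smul]
    congr 1
    field_simp
  have hcen : ∀ x, s * x = x * s := by
    intro x
    have := ce_idem_central h _ hidem x
    rw [smul_mul_assoc, mul_smul_comm] at this
    exact smul_right_injective _ (inv_ne_zero hK) this
  have hcoeff : ∀ g : G, s.coeff g = if g ∈ K then 1 else 0 := by
    intro g
    rw [hs]
    split_ifs with hg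
    · rw [MonoidAlgebra.coeff_sum, Finsupp.finsetSum_apply, Finset.sum_eq_single (⟨g, hg⟩ : K)]
      · simp
      · intro b _ hb
        have : (b : G) ≠ g := fun h => hb (Subtype.ext h)
        simp [this]
      · simp
    · rw [MonoidAlgebra.coeff_sum, Finsupp.finsetSum_apply]
      refine Finset.sum_eq_zero fun b _ => ?_
      have : (b : G) ≠ g := fun h => hg (h ▸ b.2)
      simp [this]
  refine ⟨fun k hk g => ?_⟩
  by_contra hc
  have h1 := congrArg (fun z => z.coeff (g * k)) (hcen (MonoidAlgebra.single g 1))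
  simp [hcoeff, hk, hc] at h1

theorem comm_of_idem_central (p : ℕ) [Fact p.Prime] {R : Type*} [Ring R] [Algebra (ZMod p) R]
    [Module.Finite (ZMod p) R] [IsSemisimpleRing R]
    (hid : ∀ e : R, e * e = e → ∀ x, e * x = x * e) (x y : R) : x * y = y * x := by
  classical
  obtain ⟨n, D, d, _, _, _, hd, ⟨f⟩⟩ :=
    IsSemisimpleRing.exists_algEquiv_pi_matrix_divisionRing_finite (ZMod p) R
  have hid' : ∀ e : (Π i, Matrix (Fin (d i)) (Fin (d i)) (D i)), e * e = e →
      ∀ x, e * x = x * e := by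
    intro e he x
    apply f.symm.injective
    rw [map_mul, map_mul]
    exact hid _ (by rw [← map_mul, he]) _
  have hsub : ∀ i, Subsingleton (Fin (d i)) := by
    intro i
    refine ⟨fun j k => ?_⟩
    by_contra hjk
    have h1 := hid' (Pi.single i (Matrix.single j j 1))
      (by rw [← Pi.single_mul]; simp) (Pi.single i (Matrix.single j k 1))
    rw [← Pi.single_mul, ← Pi.single_mul] at h1
    have h2 := congrFun (congrFun (Pi.single_injective i h1) j) k
    rw [Matrix.single_mul_single_same, Matrix.single_mul_single_of_ne _ _ _ _ (Ne.symm hjk)] at h2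
    simp at h2
  apply f.injective
  rw [map_mul, map_mul]
  funext i
  ext j k
  have := hsub i
  have : Finite (D i) := Module.finite_of_finite (ZMod p)
  obtain rfl := Subsingleton.elim j k
  simp only [Pi.mul_apply, Matrix.mul_apply]
  rw [Fintype.sum_subsingleton _ j, Fintype.sum_subsingleton _ j]
  exact (littleWedderburn (D i)).mul_comm _ _

theorem q_subgroup_normal_commutative
    (F : Type*) [Field F] (p : ℕ) [Fact p.Prime] [CharP F p]
    (q : ℕ) (hq : q.Prime) (hqp : q ≠ p)
    (G : Type*) [Group G]
    (h : IsCentrallyEssential (MonoidAlgebra F G))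
    (H : Subgroup G) (hH : ∀ h ∈ H, ∃ k : ℕ, orderOf h = q ^ k) :
    H.Normal ∧ ∀ x y : H, x * y = y * x := by
  have hp : p.Prime := Fact.out
  have hqF : (q : F) ≠ 0 := by
    rw [Ne, CharP.cast_eq_zero_iff F p, Nat.prime_dvd_prime_iff_eq hp hq]
    exact fun h => hqp h.symm
  have hfin : ∀ x ∈ H, Finite (Subgroup.zpowers x) := by
    intro x hx
    obtain ⟨k, hk⟩ := hH x hx
    change Finite (Subgroup.zpowers x : Set G)
    rw [Set.finite_coe_iff, finite_zpowers, ← orderOf_pos_iff, hk]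
    exact pow_pos hq.pos k
  have hnorm : ∀ x ∈ H, (Subgroup.zpowers x).Normal := by
    intro x hx
    have := hfin x hx
    obtain ⟨k, hk⟩ := hH x hx
    apply ce_subgroup_normal h
    rw [Nat.card_zpowers, hk, Nat.cast_pow]
    exact pow_ne_zero _ hqF
  refine ⟨⟨fun x hx g => ?_⟩, ?_⟩
  · have h1 := (hnorm x hx).conj_mem x (Subgroup.mem_zpowers x) g
    exact (Subgroup.zpowers_le.2 hx) h1
  rintro ⟨x, hx⟩ ⟨y, hy⟩
  apply Subtype.ext
  change x * y = y * x
  set K := Subgroup.zpowers x ⊔ Subgroup.zpowers y with hK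
  have hKH : K ≤ H := sup_le (Subgroup.zpowers_le.2 hx) (Subgroup.zpowers_le.2 hy)
  have hxK : x ∈ K := (le_sup_left : Subgroup.zpowers x ≤ K) (Subgroup.mem_zpowers x)
  have hyK : y ∈ K := (le_sup_right : Subgroup.zpowers y ≤ K) (Subgroup.mem_zpowers y)
  have hKfin : Finite K := by
    have := hnorm x hx
    have hfx := hfin x hx
    have hfy := hfin y hy
    change Finite (K : Set G)
    rw [hK, Subgroup.normal_mul]
    exact (Set.Finite.mul (Set.toFinite _) (Set.toFinite _)).to_subtype
  have hcard : (Nat.card K : ZMod p) ≠ 0 := by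
    have : Fact q.Prime := ⟨hq⟩
    have : IsPGroup q K := by
      intro k
      obtain ⟨m, hm⟩ := hH k (hKH k.2)
      refine ⟨m, Subtype.ext ?_⟩
      rw [← hm]
      simp [pow_orderOf_eq_one]
    obtain ⟨m, hm⟩ := IsPGroup.iff_card.1 this
    rw [hm, Nat.cast_pow]
    apply pow_ne_zero
    rw [Ne, CharP.cast_eq_zero_iff (ZMod p) p, Nat.prime_dvd_prime_iff_eq hp hq]
    exact fun h => hqp h.symm
  have : NeZero (Nat.card K : ZMod p) := ⟨hcard⟩
  have : IsSemisimpleRing (MonoidAlgebra (ZMod p) K) :=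
    inferInstanceAs (IsSemisimpleModule (MonoidAlgebra (ZMod p) K) (MonoidAlgebra (ZMod p) K))
  let φ : MonoidAlgebra (ZMod p) K →+* MonoidAlgebra F G :=
    (MonoidAlgebra.mapDomainRingHom F K.subtype).comp
      (MonoidAlgebra.mapRingHom K (ZMod.castHom (dvd_refl p) F))
  have hφ : Function.Injective φ := by
    have h1 : Function.Injective (MonoidAlgebra.mapDomainRingHom F K.subtype) :=
      MonoidAlgebra.mapDomain_injective K.subtype_injective
    have h2 : Function.Injective (MonoidAlgebra.mapRingHom K (ZMod.castHom (dvd_refl p) F)) :=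
      MonoidAlgebra.map_injective (ZMod.castHom (dvd_refl p) F : ZMod p →+ F)
        (ZMod.castHom (dvd_refl p) F).injective
    intro a b hab
    exact h2 (h1 hab)
  have : Module.Finite (ZMod p) (MonoidAlgebra (ZMod p) K) := inferInstance
  have hcomm := comm_of_idem_central p (R := MonoidAlgebra (ZMod p) K) (fun e he z => by
    apply hφ
    rw [map_mul, map_mul]
    exact ce_idem_central h _ (by rw [← map_mul, he]) _)
    (MonoidAlgebra.of _ _ (⟨x, hxK⟩ : K)) (MonoidAlgebra.of _ _ (⟨y, hyK⟩ : K))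
  rw [← map_mul, ← map_mul] at hcomm
  exact congrArg Subtype.val (MonoidAlgebra.of_injective hcomm)
end

section
/- For every group G of order 16 whose nilpotency class equals 3, the group algebra GF(2)[G] over the field with two elements is a centrally essential ring. -/
/-- If `H ≤ K` with `|K| = 2|H|`, two elements of `K` outside `H` are in the same coset. -/
theorem ce_aux_coset {G : Type*} [Group G] [Finite G] (H K : Subgroup G) (hle : H ≤ K)
    (hc : Nat.card K = 2 * Nat.card H) {x y : G} (hx : x ∈ K) (hy : y ∈ K)
    (hx' : x ∉ H) (hy' : y ∉ H) : x⁻¹ * y ∈ H := by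
  have hi : (H.subgroupOf K).index = 2 := by
    have h1 := (H.subgroupOf K).card_mul_index
    have h2 : Nat.card (H.subgroupOf K) = Nat.card H :=
      Nat.card_congr (Subgroup.subgroupOfEquivOfLe hle).toEquiv
    have h3 : 0 < Nat.card H := Nat.card_pos
    rw [h2, hc, mul_comm] at h1
    exact Nat.eq_of_mul_eq_mul_right h3 h1
  have := (Subgroup.mul_mem_iff_of_index_two hi (a := (⟨x, hx⟩ : K)⁻¹) (b := ⟨y, hy⟩))
  simp only [Subgroup.mem_subgroupOf, Subgroup.coe_mul, Subgroup.coe_inv, inv_mem_iff] at this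
  exact this.2 ⟨fun h => absurd h hx', fun h => absurd h hy'⟩

theorem ce_aux_group (G : Type*) [Group G] [Fintype G] (hcard : Fintype.card G = 16)
    (h3 : Subgroup.upperCentralSeries G 3 = ⊤) (h2 : Subgroup.upperCentralSeries G 2 ≠ ⊤) :
    ∃ z t a : G, (∀ g, z * g = g * z) ∧ z * z = 1 ∧ (t * t = 1 ∨ t * t = z) ∧
      t * a = a * t ∧
      (∀ g h : G, ∃ n, h⁻¹ * g * h = n * g ∧ (n = 1 ∨ n = z ∨ n = t ∨ n = t * z)) ∧
      t ≠ 1 ∧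
      (∀ g, g * a * g⁻¹ = a ∨ g * a * g⁻¹ = t * a) ∧
      (∀ g, g * (t * a) * g⁻¹ = a ∨ g * (t * a) * g⁻¹ = t * a) := by
  classical
  have hcard' : Nat.card G = 16 := by rw [Nat.card_eq_fintype_card, hcard]
  set Z1 := Subgroup.upperCentralSeries G 1 with hZ1
  set Z2 := Subgroup.upperCentralSeries G 2 with hZ2
  have m1 : ∀ x, x ∈ Z1 ↔ ∀ y, x * y = y * x := by
    intro x
    rw [hZ1, Subgroup.upperCentralSeries_one, Subgroup.mem_center_iff]
    exact forall_congr' fun y => eq_comm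
  have m2 : ∀ x, x ∈ Z2 ↔ ∀ y, x * y * x⁻¹ * y⁻¹ ∈ Z1 := fun x =>
    Subgroup.mem_upperCentralSeries_succ_iff
  have m3 : ∀ x y, x * y * x⁻¹ * y⁻¹ ∈ Z2 := by
    intro x y
    have : x ∈ Subgroup.upperCentralSeries G 3 := by rw [h3]; trivial
    exact Subgroup.mem_upperCentralSeries_succ_iff.1 this y
  have h12 : Z1 ≤ Z2 := by
    intro x hx
    rw [m2]
    intro y
    rw [(m1 x).1 hx y]
    simp [Z1.one_mem]
  have n1 : Z1.Normal := by rw [hZ1]; infer_instance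
  -- cardinalities
  have hne12 : Z1 ≠ Z2 := by
    intro h
    apply h2
    rw [eq_top_iff]
    intro x _
    rw [m2]
    intro y
    rw [h]
    exact m3 x y
  have hne1 : Z1 ≠ ⊥ := by
    intro h
    apply hne12
    rw [h]
    symm
    rw [eq_bot_iff, ← h]
    intro x hx
    rw [m1]
    intro y
    have := (m2 x).1 hx y
    rw [h, Subgroup.mem_bot] at this
    rw [mul_inv_eq_one, mul_inv_eq_iff_eq_mul] at this
    exact this
  have d1 : Nat.card Z1 ∣ Nat.card Z2 := Subgroup.card_dvd_of_le h12
  have d2 : Nat.card Z2 * Z2.index = 16 := by rw [Z2.card_mul_index, hcard']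
  have c1 : 1 < Nat.card Z1 := by
    rw [Subgroup.one_lt_card_iff_ne_bot]; exact hne1
  have c12 : Nat.card Z1 ≠ Nat.card Z2 := fun h => hne12 (Subgroup.eq_of_le_of_card_ge h12 h.ge)
  have i1 : Z2.index ≠ 1 := by rwa [Ne, Subgroup.index_eq_one]
  have i2 : Z2.index ≠ 2 := by
    intro hi
    apply h2
    rw [eq_top_iff]
    intro g _
    by_contra hg
    apply hg
    rw [m2]
    intro y
    by_cases hy : y ∈ Z2
    · have := Z1.inv_mem ((m2 y).1 hy g)
      convert this using 1
      group
    · have hn : g⁻¹ * y ∈ Z2 := by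
        rw [Subgroup.mul_mem_iff_of_index_two hi]
        simp [hg, hy]
      have := n1.conj_mem _ (Z1.inv_mem ((m2 _).1 hn g)) g
      convert this using 1
      group
  have c2 : Nat.card Z2 = 4 ∧ Nat.card Z1 = 2 := by
    have e : Nat.card Z2 ∣ 16 := ⟨_, d2.symm⟩
    generalize Nat.card Z2 = p at *
    generalize Nat.card Z1 = q at *
    generalize Z2.index = i at *
    have : p ≤ 16 := Nat.le_of_dvd (by norm_num) e
    have hp : 0 < p := Nat.pos_of_dvd_of_pos e (by norm_num)
    have : q ≤ p := Nat.le_of_dvd hp d1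
    interval_cases p <;> first | omega | skip
    interval_cases q <;> omega
  obtain ⟨c2, c1'⟩ := c2
  obtain ⟨z, hz, hz1⟩ := (Subgroup.ne_bot_iff_exists_ne_one).1 hne1 |>.elim
    fun x hx => (⟨x.1, x.2, fun h => hx (Subtype.ext h)⟩ : ∃ z, z ∈ Z1 ∧ z ≠ 1)
  have l1 : ∀ x ∈ Z1, x = 1 ∨ x = z := by
    intro x hx
    by_contra! hcon
    have := ce_aux_coset ⊥ Z1 bot_le (by rw [c1', Subgroup.card_bot]) hz hx (by simpa using hz1)
      (by simpa using hcon.1)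
    rw [Subgroup.mem_bot, inv_mul_eq_one] at this
    exact hcon.2 this.symm
  have hzz : z * z = 1 := by
    rcases l1 _ (Z1.mul_mem hz hz) with h | h
    · exact h
    · exact absurd (mul_eq_left.1 h) hz1
  have hzc := (m1 z).1 hz
  have l2 : ∀ t ∈ Z2, t ∉ Z1 → ∀ x ∈ Z2, x = 1 ∨ x = z ∨ x = t ∨ x = t * z := by
    intro t ht ht1 x hx
    by_cases hx1 : x ∈ Z1
    · rcases l1 x hx1 with h | h <;> simp [h]
    · rcases l1 _ (ce_aux_coset Z1 Z2 h12 (by rw [c1', c2]) ht hx ht1 hx1) with h | h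
      · right; right; left
        exact (inv_mul_eq_one.1 h).symm
      · right; right; right
        exact inv_mul_eq_iff_eq_mul.1 h
  obtain ⟨t0, ht0, ht01⟩ := SetLike.exists_of_lt (lt_of_le_of_ne h12 hne12)
  obtain ⟨g0, hg0⟩ : ∃ g, t0 * g ≠ g * t0 := by
    by_contra! h
    exact ht01 ((m1 t0).2 h)
  have hconj : ∀ g, g * t0 = t0 * g ∨ g * t0 = t0 * g * z := by
    intro g
    rcases l1 _ ((m2 t0).1 ht0 g) with h | h
    · left
      rw [mul_inv_eq_one, mul_inv_eq_iff_eq_mul] at h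
      exact h.symm
    · right
      rw [mul_inv_eq_iff_eq_mul, mul_inv_eq_iff_eq_mul] at h
      rw [h, ← hzc, ← mul_assoc, ← mul_assoc, hzz, one_mul]
  let A : Subgroup G := Subgroup.centralizer {t0}
  have mA : ∀ g, g ∈ A ↔ g * t0 = t0 * g := by
    intro g
    simp only [A, Subgroup.mem_centralizer_singleton_iff]
  have hg0A : g0 ∉ A := fun h => hg0 ((mA g0).1 h).symm
  have hAA : ∀ g h, g ∉ A → h ∉ A → g * h ∈ A := by
    intro g h hg hh
    have e1 := (hconj g).resolve_left (fun q => hg ((mA g).2 q))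
    have e2 := (hconj h).resolve_left (fun q => hh ((mA h).2 q))
    rw [mA]
    calc g * h * t0 = g * (h * t0) := by group
      _ = (g * t0) * h * z := by rw [e2]; group
      _ = t0 * g * (z * h) * z := by rw [e1]; group
      _ = t0 * (g * h) * (z * z) := by rw [hzc h]; group
      _ = t0 * (g * h) := by rw [hzz, mul_one]
  have iA : A.index = 2 := by
    rw [Subgroup.index_eq_two_iff]
    refine ⟨g0, fun b => ?_⟩
    by_cases hb : b ∈ A
    · right
      exact ⟨hb, fun h => hg0A ((A.mul_mem_cancel_left hb).1 h)⟩
    · left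
      exact ⟨hAA _ _ hb hg0A, hb⟩
  have cA : Nat.card A = 8 := by
    have := A.card_mul_index
    rw [iA, hcard'] at this
    omega
  have h2A : Z2 ≤ A := by
    intro x hx
    rw [mA]
    rcases l2 t0 ht0 ht01 x hx with h | h | h | h
    · simp [h]
    · rw [h, hzc]
    · rw [h]
    · rw [h, mul_assoc, hzc]
  have hne2A : Z2 ≠ A := by
    intro h
    rw [h] at c2
    omega
  obtain ⟨a, haA, ha2⟩ := SetLike.exists_of_lt (lt_of_le_of_ne h2A hne2A)
  have hat := (mA a).1 haA
  have comZ2 : ∀ x ∈ Z2, x * a = a * x := by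
    intro x hx
    rcases l2 t0 ht0 ht01 x hx with h | h | h | h
    · simp [h]
    · rw [h, hzc]
    · rw [h, hat]
    · rw [h, mul_assoc, hzc, ← mul_assoc, ← hat, mul_assoc]
  have comA : ∀ x ∈ A, x * a = a * x := by
    intro x hx
    by_cases hx2 : x ∈ Z2
    · exact comZ2 x hx2
    · have := comZ2 _ (ce_aux_coset Z2 A h2A (by rw [c2, cA]) haA hx ha2 hx2)
      rw [mul_assoc, inv_mul_eq_iff_eq_mul] at this
      rw [this]
      group
  let t : G := g0 * a * g0⁻¹ * a⁻¹
  have hta : t * a = g0 * a * g0⁻¹ := by simp [t]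
  have ht2 : t ∈ Z2 := m3 g0 a
  have cl : ∀ g, g * a * g⁻¹ = a ∨ g * a * g⁻¹ = t * a := by
    intro g
    by_cases hg : g ∈ A
    · left
      rw [comA g hg]
      group
    · right
      have hm : g0⁻¹ * g ∈ A := hAA _ _ (fun h => hg0A (A.inv_mem_iff.1 h)) hg
      have := comA _ hm
      rw [hta]
      have e : g = g0 * (g0⁻¹ * g) := by group
      generalize g0⁻¹ * g = m at *
      subst e
      calc g0 * m * a * (g0 * m)⁻¹ = g0 * (m * a) * m⁻¹ * g0⁻¹ := by group
        _ = g0 * a * g0⁻¹ := by rw [this]; group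
  have ht1 : t ∉ Z1 := by
    intro h
    apply ha2
    rw [m2]
    intro y
    have : y * a * y⁻¹ * a⁻¹ ∈ Z1 := by
      rcases cl y with h' | h' <;> rw [h']
      · simp [Z1.one_mem]
      · simpa using h
    have := Z1.inv_mem this
    convert this using 1
    group
  refine ⟨z, t, a, hzc, hzz, ?_, comZ2 t ht2, ?_, ?_, cl, ?_⟩
  · rcases l2 t ht2 ht1 _ (Z2.mul_mem ht2 ht2) with h | h | h | h
    · exact Or.inl h
    · exact Or.inr h
    · exact absurd (by rw [mul_eq_left.1 h]; exact Z1.one_mem) ht1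
    · exact absurd (by rw [mul_left_cancel h]; exact hz) ht1
  · intro g h
    refine ⟨h⁻¹ * g * h * g⁻¹, by group, l2 t ht2 ht1 _ ?_⟩
    simpa using m3 h⁻¹ g
  · intro h
    exact ht1 (h ▸ Z1.one_mem)
  · intro g
    have := cl (g * g0)
    rw [hta] at this ⊢
    convert this using 2 <;> group

theorem ce_aux_center {G : Type*} [Group G] (r : MonoidAlgebra (ZMod 2) G)
    (h : ∀ g : G, MonoidAlgebra.single g 1 * r = r * MonoidAlgebra.single g 1) :
    r ∈ Subring.center (MonoidAlgebra (ZMod 2) G) := by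
  rw [Subring.mem_center_iff]
  intro x
  induction x using MonoidAlgebra.induction_on with
  | of g => simpa using h g
  | add x y hx hy => rw [add_mul, mul_add, hx, hy]
  | smul c x hx => rw [smul_mul_assoc, mul_smul_comm, hx]

theorem centrally_essential_of_order_sixteen_class_three
    (G : Type*) [Group G] [Fintype G] (hcard : Fintype.card G = 16)
    (h3 : upperCentralSeries G 3 = ⊤) (h2 : upperCentralSeries G 2 ≠ ⊤) :
    IsCentrallyEssential (MonoidAlgebra (ZMod 2) G) := by
  classical
  obtain ⟨z, t, a, hzc, hzz, htt, hta, hcomm, ht1, cl1, cl2⟩ := ce_aux_group G hcard h3 h2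
  let δ : G → MonoidAlgebra (ZMod 2) G := fun g => MonoidAlgebra.single g 1
  have δm : ∀ g h, δ g * δ h = δ (g * h) := by
    intro g h
    simp [δ, MonoidAlgebra.single_mul_single]
  have δ1 : δ 1 = 1 := rfl
  have two : ∀ x : MonoidAlgebra (ZMod 2) G, x + x = 0 := by
    intro x
    rw [← two_smul (ZMod 2) x, show (2 : ZMod 2) = 0 from rfl, zero_smul]
  have eqz : ∀ x y : MonoidAlgebra (ZMod 2) G, x + y = 0 → x = y := by
    intro x y h
    have := congrArg (· + y) h
    simpa [add_assoc, two] using this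
  -- elements invariant under the second center are central
  have key : ∀ r, δ z * r = r → δ t * r = r → r ∈ Subring.center (MonoidAlgebra (ZMod 2) G) := by
    intro r hz ht
    have inv : ∀ n, (n = 1 ∨ n = z ∨ n = t ∨ n = t * z) → δ n * r = r := by
      rintro n (h | h | h | h) <;> rw [h]
      · rw [δ1, one_mul]
      · exact hz
      · exact ht
      · rw [← δm, mul_assoc, hz, ht]
    have inv' : ∀ n, (n = 1 ∨ n = z ∨ n = t ∨ n = t * z) → ∀ g, r.coeff (n * g) = r.coeff g := by
      intro n hn g
      conv_lhs => rw [← inv n hn]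
      simp [δ, MonoidAlgebra.single_mul_apply]
    apply ce_aux_center
    intro h
    ext g
    rw [MonoidAlgebra.single_mul_apply, MonoidAlgebra.mul_single_apply, one_mul, mul_one]
    obtain ⟨n, e, hn⟩ := hcomm (g * h⁻¹) h
    have e2 : h⁻¹ * g = n * (g * h⁻¹) := by rw [← e]; group
    rw [e2, inv' n hn]
  have cz : 1 + δ z ∈ Subring.center (MonoidAlgebra (ZMod 2) G) := by
    apply ce_aux_center
    intro g
    change δ g * _ = _ * δ g
    rw [mul_add, add_mul, δm, δm, hzc, mul_one, one_mul]
  have cs : δ a + δ (t * a) ∈ Subring.center (MonoidAlgebra (ZMod 2) G) := by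
    apply ce_aux_center
    intro g
    change δ g * _ = _ * δ g
    rw [mul_add, add_mul, δm, δm, δm, δm]
    have hne : g * a * g⁻¹ ≠ g * (t * a) * g⁻¹ := by
      intro h
      have := mul_left_cancel (mul_right_cancel h)
      exact ht1 (mul_eq_right.1 this.symm)
    rcases cl1 g with h | h <;> rcases cl2 g with h' | h'
    · exact absurd (h.trans h'.symm) hne
    · rw [mul_inv_eq_iff_eq_mul.1 h, mul_inv_eq_iff_eq_mul.1 h']
    · rw [mul_inv_eq_iff_eq_mul.1 h, mul_inv_eq_iff_eq_mul.1 h', add_comm]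
    · exact absurd (h.trans h'.symm) hne
  intro r hr
  -- first step
  obtain ⟨c, hc, hcr, hzr⟩ : ∃ c ∈ Subring.center (MonoidAlgebra (ZMod 2) G),
      c * r ≠ 0 ∧ δ z * (c * r) = c * r := by
    by_cases h : (1 + δ z) * r = 0
    · refine ⟨1, Subring.one_mem _, by simpa using hr, ?_⟩
      rw [add_mul, one_mul] at h
      rw [one_mul, ← eqz _ _ h]
    · refine ⟨1 + δ z, cz, h, ?_⟩
      rw [← mul_assoc, mul_add, δm, hzz, δ1, mul_one, add_comm]
  have hat : ∀ x, δ (t * a) * x = δ a * (δ t * x) := by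
    intro x
    rw [hta, ← δm, mul_assoc]
  by_cases h : (δ a + δ (t * a)) * (c * r) = 0
  · refine ⟨c, hc, hcr, key _ hzr ?_⟩
    rw [add_mul, hat] at h
    have := congrArg (fun x => δ a⁻¹ * x) (eqz _ _ h)
    simp only [← mul_assoc, δm] at this
    simp only [inv_mul_cancel, δ1, one_mul] at this
    rw [← mul_assoc]
    exact this.symm
  · refine ⟨(δ a + δ (t * a)) * c, Subring.mul_mem _ cs hc, by rwa [mul_assoc], ?_⟩
    rw [mul_assoc]
    have za : ∀ g, δ z * (δ g * (c * r)) = δ g * (c * r) := by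
      intro g
      rw [← mul_assoc, δm, hzc, ← δm, mul_assoc, hzr]
    apply key
    · rw [add_mul, mul_add, za, za]
    · have htt' : δ (t * t) * (δ a * (c * r)) = δ a * (c * r) := by
        rcases htt with e | e <;> rw [e]
        · rw [δ1, one_mul]
        · exact za a
      rw [add_mul, ← δm t a, mul_assoc (δ t), mul_add, ← mul_assoc (δ t) (δ t), δm t t, htt',
        add_comm]
end
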